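/- Let σ > 0 be fixed and set E(αβ) = ∑_{k=0}^∞ σ²·ρ^{2k+1}. Let D : (1,∞) → (0,∞) satisfy D(x) = Ω(x) as x → ∞ (that is, liminf_{x→∞} D(x)/x > 0) and 0 < D(αβ) < E(αβ) for all αβ > 1. For each pair α, β > 0 with αβ > 1 let w = w(αβ) ∈ (0, σ²·ρ) be the (unique) level satisfying D(αβ) = ∑_{k=0}^∞ min{ w, σ²·ρ^{2k+1} }, and define R(αβ) = ∑_{k=0}^∞ (1/2)·ln_+( σ²·ρ^{2k+1} / w ). Set Φ(t,ω) = (σ²/(2π))·(1/cosh δ)·exp(−t²/α² − ω²/β²) and λ = λ(αβ) = w(αβ)/(2π). Then R ≐ (1/(2π)) ∬_{ℝ²} max{ 0, (1/2)·ln( Φ(t,ω) / λ ) } dt dω, i.e., the difference between the two sides is o(αβ) as αβ → ∞. -/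

import Mathlib

open MeasureTheory

/-- `dlt x` is δ = arccoth x, i.e. the positive solution of coth δ = x for x > 1. -/
noncomputable def dlt (x : ℝ) : ℝ := (1/2) * Real.log ((x + 1) / (x - 1))

/-- `rho x` is ρ = e^{-δ} where coth δ = x. -/
noncomputable def rho (x : ℝ) : ℝ := Real.exp (-dlt x)

/-- `lnplus x = max {0, ln x}` (with `lnplus 0 = 0`, since `Real.log 0 = 0`). -/
noncomputable def lnplus (x : ℝ) : ℝ := max 0 (Real.log x)

theorem dlt_le {x : ℝ} (hx : 1 < x) : dlt x ≤ 1 / (x - 1) := by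
  have h1 : 0 < x - 1 := by linarith
  have h := Real.log_le_sub_one_of_pos (show 0 < (x + 1) / (x - 1) by positivity)
  have e : (x + 1) / (x - 1) - 1 = 2 * (1 / (x - 1)) := by field_simp; ring
  unfold dlt
  linarith

theorem le_dlt {x : ℝ} (hx : 1 < x) : 1 / (x + 1) ≤ dlt x := by
  have h1 : 0 < x - 1 := by linarith
  have h := Real.one_sub_inv_le_log_of_pos (show 0 < (x + 1) / (x - 1) by positivity)
  have e : 1 - ((x + 1) / (x - 1))⁻¹ = 2 * (1 / (x + 1)) := by field_simp; ring
  unfold dlt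
  linarith

theorem dlt_pos {x : ℝ} (hx : 1 < x) : 0 < dlt x :=
  lt_of_lt_of_le (by positivity) (le_dlt hx)

theorem rho_pos (x : ℝ) : 0 < rho x := Real.exp_pos _

theorem rho_lt_one {x : ℝ} (hx : 1 < x) : rho x < 1 :=
  Real.exp_lt_one_iff.mpr (neg_lt_zero.mpr (dlt_pos hx))

theorem rho_sq {x : ℝ} (hx : 1 < x) : rho x ^ 2 = (x - 1) / (x + 1) := by
  have h1 : 0 < x - 1 := by linarith
  have e : rho x ^ 2 = Real.exp (-Real.log ((x + 1) / (x - 1))) := by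
    rw [rho, ← Real.exp_nat_mul]
    congr 1
    unfold dlt
    push_cast
    ring
  rw [e, Real.exp_neg, Real.exp_log (by positivity), inv_div]

theorem inv_one_sub_rho_le {x : ℝ} (hx : 1 < x) : (1 - rho x)⁻¹ ≤ 2 * x := by
  have h0 := rho_pos x
  have h1 := rho_lt_one hx
  have h2 := rho_sq hx
  rw [eq_div_iff (by positivity)] at h2
  rw [inv_le_comm₀ (by linarith) (by positivity), inv_le_iff_one_le_mul₀ (by positivity)]
  nlinarith

/-- The geometric sequence capped at level `w` sums to at most `2 σ x √w`. -/
theorem tsum_min_le {x σ w : ℝ} (hx : 1 < x) (hσ : 0 < σ) (hw : 0 < w) :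
    ∑' k : ℕ, min w (σ ^ 2 * rho x ^ (2 * k + 1)) ≤ √w * σ * (2 * x) := by
  have h0 := rho_pos x
  have h1 := rho_lt_one hx
  have hg : Summable fun k : ℕ => √w * σ * rho x ^ k :=
    (summable_geometric_of_lt_one h0.le h1).mul_left _
  have hle : ∀ k : ℕ, min w (σ ^ 2 * rho x ^ (2 * k + 1)) ≤ √w * σ * rho x ^ k := by
    intro k
    have hk : 0 < σ * rho x ^ k := by positivity
    have hs : √w ^ 2 = w := Real.sq_sqrt hw.le
    have hs0 : 0 < √w := Real.sqrt_pos.mpr hw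
    rcases le_total (√w) (σ * rho x ^ k) with h | h
    · exact (min_le_left _ _).trans (by nlinarith)
    · refine (min_le_right _ _).trans ?_
      have e : σ ^ 2 * rho x ^ (2 * k + 1) = (σ * rho x ^ k) ^ 2 * rho x := by ring
      rw [e]
      nlinarith [mul_pos hk hk]
  have hmin : Summable fun k : ℕ => min w (σ ^ 2 * rho x ^ (2 * k + 1)) :=
    hg.of_nonneg_of_le (fun k => le_min hw.le (by positivity)) hle
  refine (hmin.tsum_le_tsum hle hg).trans ?_
  rw [tsum_mul_left, tsum_geometric_of_lt_one h0.le h1]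
  exact mul_le_mul_of_nonneg_left (inv_one_sub_rho_le hx) (by positivity)

/-- The midpoint rule for `∫₀^L (L - u) du` with step `2 δ`. -/
theorem abs_tsum_max_sub_le {L δ : ℝ} (hL : 0 ≤ L) (hδ : 0 < δ) :
    |∑' k : ℕ, max 0 (L - (2 * k + 1) * δ) - L ^ 2 / (4 * δ)| ≤ δ / 4 := by
  set y := L / (2 * δ) + 1 / 2 with hy
  have hy0 : 0 ≤ y := by positivity
  have hLy : L = (2 * y - 1) * δ := by rw [hy]; field_simp; ring
  set N := ⌊y⌋₊
  have hN1 : (N : ℝ) ≤ y := Nat.floor_le hy0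
  have hN2 : y < N + 1 := Nat.lt_floor_add_one y
  have hsum : ∑' k : ℕ, max 0 (L - (2 * k + 1) * δ) =
      ∑ k ∈ Finset.range N, (L - (2 * (k : ℝ) + 1) * δ) := by
    rw [tsum_eq_sum (s := Finset.range N)]
    · refine Finset.sum_congr rfl fun k hk => max_eq_right ?_
      have : (k : ℝ) + 1 ≤ N := by exact_mod_cast Finset.mem_range.mp hk
      rw [hLy]
      nlinarith
    · intro k hk
      have : (N : ℝ) ≤ k := by
        exact_mod_cast not_lt.mp fun h => hk (Finset.mem_range.mpr h)
      refine max_eq_left ?_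
      rw [hLy]
      nlinarith
  have hclosed : ∀ n : ℕ, ∑ k ∈ Finset.range n, (L - (2 * (k : ℝ) + 1) * δ) =
      n * L - n ^ 2 * δ := by
    intro n
    induction n with
    | zero => simp
    | succ n ih => rw [Finset.sum_range_succ, ih]; push_cast; ring
  have e : N * L - N ^ 2 * δ - L ^ 2 / (4 * δ) = -(δ * (N - y + 1 / 2) ^ 2) := by
    rw [hLy]; field_simp; ring
  rw [hsum, hclosed, e, abs_neg, abs_of_nonneg (by positivity)]
  have : (N - y + 1 / 2) ^ 2 ≤ 1 / 4 := by nlinarith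
  nlinarith

theorem integral_Ioi_mul_max_sub_sq {a : ℝ} (ha : 0 ≤ a) :
    ∫ r in Set.Ioi (0 : ℝ), r * max 0 (a - r ^ 2) = a ^ 2 / 4 := by
  have hs : √a ^ 2 = a := Real.sq_sqrt ha
  have hs0 : 0 ≤ √a := Real.sqrt_nonneg a
  have h1 : ∫ r in Set.Ioi (0 : ℝ), r * max 0 (a - r ^ 2) =
      ∫ r in Set.Ioc (0 : ℝ) √a, r * max 0 (a - r ^ 2) := by
    refine (setIntegral_eq_of_subset_of_forall_sdiff_eq_zero measurableSet_Ioi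
      Set.Ioc_subset_Ioi_self ?_)
    rintro r ⟨hr, hr'⟩
    have hr0 : 0 < r := hr
    have : √a < r := by
      by_contra! h
      exact hr' ⟨hr0, h⟩
    rw [max_eq_left (by nlinarith), mul_zero]
  have h2 : ∫ r in Set.Ioc (0 : ℝ) √a, r * max 0 (a - r ^ 2) =
      ∫ r in (0 : ℝ)..√a, r * (a - r ^ 2) := by
    rw [intervalIntegral.integral_of_le hs0]
    refine setIntegral_congr_fun measurableSet_Ioc fun r hr => ?_
    have : 0 ≤ a - r ^ 2 := by nlinarith [hr.1, hr.2]
    simp only [max_eq_right this]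
  rw [h1, h2, intervalIntegral.integral_eq_sub_of_hasDerivAt
    (f := fun r => a * r ^ 2 / 2 - r ^ 4 / 4)]
  · have : √a ^ 4 = a ^ 2 := by rw [← hs]; ring_nf; simp [hs]
    simp only [this, hs]
    ring
  · intro r _
    have := (((hasDerivAt_pow 2 r).const_mul a).div_const 2).sub
      ((hasDerivAt_pow 4 r).div_const 4)
    refine this.congr_deriv ?_
    push_cast
    ring
  · exact Continuous.intervalIntegrable (by fun_prop) _ _

/-- Volume under the paraboloid `a - t² - ω²`. -/
theorem integral_integral_max_sub_sq {a : ℝ} (ha : 0 ≤ a) :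
    ∫ t : ℝ, ∫ ω : ℝ, max 0 (a - t ^ 2 - ω ^ 2) = Real.pi * a ^ 2 / 2 := by
  have hc : Continuous fun p : ℝ × ℝ => max 0 (a - p.1 ^ 2 - p.2 ^ 2) := by fun_prop
  have hsupp : HasCompactSupport fun p : ℝ × ℝ => max 0 (a - p.1 ^ 2 - p.2 ^ 2) := by
    refine HasCompactSupport.intro (isCompact_Icc (a := ((-√a, -√a) : ℝ × ℝ)) (b := (√a, √a))) ?_
    intro p hp
    by_contra h
    apply hp
    have hpos : 0 < a - p.1 ^ 2 - p.2 ^ 2 := by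
      by_contra! h'
      exact h (max_eq_left h')
    have b1 : |p.1| ≤ √a := Real.abs_le_sqrt (by nlinarith [sq_nonneg p.2])
    have b2 : |p.2| ≤ √a := Real.abs_le_sqrt (by nlinarith [sq_nonneg p.1])
    exact ⟨⟨(abs_le.mp b1).1, (abs_le.mp b2).1⟩, ⟨(abs_le.mp b1).2, (abs_le.mp b2).2⟩⟩
  have hint := hc.integrable_of_hasCompactSupport (μ := volume) hsupp
  rw [← integral_prod (fun p : ℝ × ℝ => max 0 (a - p.1 ^ 2 - p.2 ^ 2)) hint,
    ← Measure.volume_eq_prod, ← integral_comp_polarCoord_symm]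
  have e : ∀ p : ℝ × ℝ, p.1 • max 0 (a - (polarCoord.symm p).1 ^ 2 - (polarCoord.symm p).2 ^ 2) =
      (p.1 * max 0 (a - p.1 ^ 2)) * 1 := by
    intro p
    have : a - (p.1 * Real.cos p.2) ^ 2 - (p.1 * Real.sin p.2) ^ 2 = a - p.1 ^ 2 := by
      linear_combination (-p.1 ^ 2) * Real.sin_sq_add_cos_sq p.2
    simp only [polarCoord_symm_apply, this, smul_eq_mul, mul_one]
  simp_rw [e]
  rw [polarCoord_target, Measure.volume_eq_prod,
    setIntegral_prod_mul (fun r : ℝ => r * max 0 (a - r ^ 2)) (fun _ : ℝ => (1 : ℝ)),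
    integral_Ioi_mul_max_sub_sq ha]
  simp only [integral_const, MeasurableSet.univ, measureReal_restrict_apply, Set.univ_inter,
    Real.volume_real_Ioo, smul_eq_mul, mul_one]
  rw [max_eq_left (by linarith [Real.pi_pos])]
  ring

theorem integral_integral_max_sub_div_sq {a α β : ℝ} (ha : 0 ≤ a) (hα : 0 < α) (hβ : 0 < β) :
    ∫ t : ℝ, ∫ ω : ℝ, max 0 (a - t ^ 2 / α ^ 2 - ω ^ 2 / β ^ 2) =
      α * β * (Real.pi * a ^ 2 / 2) := by
  have inner : ∀ t : ℝ, ∫ ω : ℝ, max 0 (a - t ^ 2 / α ^ 2 - ω ^ 2 / β ^ 2) =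
      β * ∫ ω : ℝ, max 0 (a - (t / α) ^ 2 - ω ^ 2) := by
    intro t
    have := Measure.integral_comp_div (fun ω : ℝ => max 0 (a - (t / α) ^ 2 - ω ^ 2)) β
    simp only [div_pow] at this ⊢
    rw [this, abs_of_pos hβ, smul_eq_mul]
  simp_rw [inner]
  rw [integral_const_mul,
    Measure.integral_comp_div (fun t : ℝ => ∫ ω : ℝ, max 0 (a - t ^ 2 - ω ^ 2)) α,
    abs_of_pos hα, smul_eq_mul, integral_integral_max_sub_sq ha]
  ring

theorem log_cosh_nonneg (u : ℝ) : 0 ≤ Real.log (Real.cosh u) :=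
  Real.log_nonneg (Real.one_le_cosh u)

theorem log_cosh_le {u : ℝ} (hu : 0 ≤ u) : Real.log (Real.cosh u) ≤ u := by
  rw [Real.log_le_iff_le_exp (Real.cosh_pos u), Real.cosh_eq]
  have : Real.exp (-u) ≤ Real.exp u := Real.exp_le_exp.mpr (by linarith)
  linarith

/-- The two main terms of the rate differ by a bounded amount. -/
theorem abs_rate_sub_le {x δ L K h T : ℝ} (hx : 2 < x) (hδ1 : 1 / (x + 1) ≤ δ)
    (hδ2 : δ ≤ 1 / (x - 1)) (hL : δ < L) (hLK : L ≤ K) (h0 : 0 ≤ h) (hh : h ≤ δ)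
    (hT : |T - L ^ 2 / (4 * δ)| ≤ δ / 4) :
    |1 / 2 * T - x * (L - h) ^ 2 / 8| ≤ K ^ 2 / 8 + K / 2 + 1 / 8 := by
  have hδ0 : 0 < δ := lt_of_lt_of_le (by positivity) hδ1
  have hx1 : 0 < x - 1 := by linarith
  rw [div_le_iff₀ (by positivity)] at hδ1
  rw [le_div_iff₀ hx1] at hδ2
  have hδle : δ ≤ 1 := by nlinarith
  have hxδ : x * δ ≤ 2 := by nlinarith
  have hd : |1 / δ - x| ≤ 1 := by
    rw [abs_le]
    constructor
    · have : x - 1 ≤ 1 / δ := by rw [le_div_iff₀ hδ0]; linarith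
      linarith
    · have : 1 / δ ≤ x + 1 := by rw [div_le_iff₀ hδ0]; linarith
      linarith
  have e : 1 / 2 * T - x * (L - h) ^ 2 / 8 =
      1 / 2 * (T - L ^ 2 / (4 * δ)) + L ^ 2 / 8 * (1 / δ - x) + x * h * (2 * L - h) / 8 := by
    field_simp
    ring
  have b2 : |L ^ 2 / 8 * (1 / δ - x)| ≤ K ^ 2 / 8 := by
    rw [abs_mul, abs_of_nonneg (by positivity)]
    have : L ^ 2 ≤ K ^ 2 := by nlinarith
    nlinarith [abs_nonneg (1 / δ - x), sq_nonneg L]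
  have b3 : |x * h * (2 * L - h) / 8| ≤ K / 2 := by
    have hxh : x * h ≤ 2 := by nlinarith
    have hxh0 : 0 ≤ x * h := by positivity
    rw [abs_of_nonneg (by have : 0 ≤ 2 * L - h := by linarith
                          positivity)]
    nlinarith
  have b1 : |1 / 2 * (T - L ^ 2 / (4 * δ))| ≤ 1 / 8 := by
    rw [abs_mul, abs_of_pos (by norm_num : (0 : ℝ) < 1 / 2)]
    linarith
  rw [e]
  refine (abs_add_three _ _ _).trans ?_
  linarith

theorem log_mul_rho_pow_div {x σ w : ℝ} (hσ : 0 < σ) (hw : 0 < w) (n : ℕ) :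
    Real.log (σ ^ 2 * rho x ^ n / w) = Real.log (σ ^ 2 / w) - n * dlt x := by
  have e : σ ^ 2 * rho x ^ n / w = σ ^ 2 / w * rho x ^ n := by ring
  rw [e, Real.log_mul (by positivity) (pow_pos (rho_pos x) n).ne', Real.log_pow, rho,
    Real.log_exp]
  ring

theorem log_spectrum_div {σ w u s : ℝ} (hσ : 0 < σ) (hw : 0 < w) :
    Real.log ((σ ^ 2 / (2 * Real.pi) * (Real.cosh u)⁻¹ * Real.exp s) / (w / (2 * Real.pi))) =
      Real.log (σ ^ 2 / w) - Real.log (Real.cosh u) + s := by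
  have hc := Real.cosh_pos u
  have hp := Real.pi_pos
  have e : (σ ^ 2 / (2 * Real.pi) * (Real.cosh u)⁻¹ * Real.exp s) / (w / (2 * Real.pi)) =
      σ ^ 2 / w / Real.cosh u * Real.exp s := by
    field_simp
  rw [e, Real.log_mul (by positivity) (Real.exp_pos s).ne', Real.log_exp,
    Real.log_div (by positivity) hc.ne']

/-- Rate half of the reverse waterfilling theorem for the nonstationary source:
`R ≐ (1/(2π)) ∬ max{0, (1/2) ln(Φ(t,ω)/λ)} dt dω` as `αβ → ∞`. -/
theorem source_rate_reverse_waterfilling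
    (σ : ℝ) (hσ : 0 < σ)
    (D : ℝ → ℝ) (hDpos : ∀ x, 1 < x → 0 < D x)
    (hDΩ : ∃ c M : ℝ, 0 < c ∧ 1 < M ∧ ∀ x, M < x → c * x ≤ D x)
    (hDE : ∀ x, 1 < x → D x < ∑' k : ℕ, σ^2 * (rho x)^(2*k+1))
    (w : ℝ → ℝ)
    (hw : ∀ x, 1 < x → 0 < w x ∧ w x < σ^2 * rho x)
    (hwD : ∀ x, 1 < x → (∑' k : ℕ, min (w x) (σ^2 * (rho x)^(2*k+1))) = D x)
    (R : ℝ → ℝ)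
    (hR : ∀ x, 1 < x → R x = ∑' k : ℕ, (1/2) * lnplus (σ^2 * (rho x)^(2*k+1) / w x)) :
    ∀ ε > 0, ∃ M, 1 < M ∧ ∀ α β : ℝ, 0 < α → 0 < β → M < α * β →
      |R (α * β) -
        (1/(2*Real.pi)) * ∫ t : ℝ, ∫ ω : ℝ,
          max 0 ((1/2) * Real.log
            (((σ^2/(2*Real.pi)) * (Real.cosh (dlt (α*β)))⁻¹ *
                Real.exp (-(t^2/α^2) - ω^2/β^2)) / (w (α*β) / (2*Real.pi))))|
        ≤ ε * (α * β) := by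
  intro ε hε
  obtain ⟨c, M₀, hc, hM₀, hD⟩ := hDΩ
  set K := Real.log (σ ^ 2 / (c / (2 * σ)) ^ 2)
  set C := K ^ 2 / 8 + K / 2 + 1 / 8 with hC
  refine ⟨max (max M₀ 2) (C / ε), lt_max_of_lt_left (lt_max_of_lt_left hM₀), ?_⟩
  intro α β hα hβ hM
  have hxM : M₀ < α * β := lt_of_le_of_lt ((le_max_left _ _).trans (le_max_left _ _)) hM
  have hx2 : 2 < α * β := lt_of_le_of_lt ((le_max_right _ _).trans (le_max_left _ _)) hM
  have hxC : C / ε < α * β := lt_of_le_of_lt (le_max_right _ _) hM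
  generalize hxdef : α * β = x at *
  have hx : 1 < x := by linarith
  obtain ⟨hw0, hw1⟩ := hw x hx
  have hδ := dlt_pos hx
  set L := Real.log (σ ^ 2 / w x)
  have hL : dlt x < L := by
    have h := Real.log_pos ((one_lt_div hw0).mpr hw1)
    have h' := log_mul_rho_pow_div (x := x) hσ hw0 1
    rw [pow_one] at h'
    rw [h'] at h
    push_cast at h
    linarith
  have hLK : L ≤ K := by
    have h1 := hD x hxM
    rw [← hwD x hx] at h1
    have h2 := h1.trans (tsum_min_le hx hσ hw0)
    have h3 : c / (2 * σ) ≤ √(w x) := by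
      rw [div_le_iff₀ (by positivity)]
      nlinarith
    have h4 : (c / (2 * σ)) ^ 2 ≤ w x := by
      rw [← Real.sq_sqrt hw0.le]
      gcongr
    exact Real.log_le_log (by positivity) (by gcongr)
  have hRx : R x = 1 / 2 * ∑' k : ℕ, max 0 (L - (2 * k + 1) * dlt x) := by
    rw [hR x hx, tsum_mul_left]
    simp only [lnplus, log_mul_rho_pow_div hσ hw0]
    push_cast
    rfl
  have hh0 := log_cosh_nonneg (dlt x)
  have hh := log_cosh_le hδ.le
  have hI : (1 / (2 * Real.pi)) * ∫ t : ℝ, ∫ ω : ℝ, max 0 ((1 / 2) * Real.log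
      (((σ ^ 2 / (2 * Real.pi)) * (Real.cosh (dlt x))⁻¹ *
        Real.exp (-(t ^ 2 / α ^ 2) - ω ^ 2 / β ^ 2)) / (w x / (2 * Real.pi)))) =
      x * (L - Real.log (Real.cosh (dlt x))) ^ 2 / 8 := by
    have e : ∀ t ω : ℝ, max 0 ((1 / 2) * Real.log
        (((σ ^ 2 / (2 * Real.pi)) * (Real.cosh (dlt x))⁻¹ *
          Real.exp (-(t ^ 2 / α ^ 2) - ω ^ 2 / β ^ 2)) / (w x / (2 * Real.pi)))) =
        (1 / 2) * max 0 (L - Real.log (Real.cosh (dlt x)) - t ^ 2 / α ^ 2 - ω ^ 2 / β ^ 2) := by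
      intro t ω
      rw [log_spectrum_div hσ hw0, mul_max_of_nonneg _ _ (by norm_num), mul_zero]
      congr 2
      ring
    simp_rw [e, integral_const_mul]
    rw [integral_integral_max_sub_div_sq (by linarith) hα hβ, hxdef]
    field_simp
    ring
  rw [hRx, hI]
  refine (abs_rate_sub_le hx2 (le_dlt hx) (dlt_le hx) hL hLK hh0 hh
    (abs_tsum_max_sub_le (by linarith) hδ)).trans ?_
  rw [div_lt_iff₀ hε] at hxC
  linarith
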